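/- Let K=K(c) be an A_n-crystal, 0<=a<=c, and D in Z^{n-1} with -a_{k+1}<=D_k<=c_k-a_k for k=1,...,n-1. Then: (i) the function f_{a,D} is feasible in the crossing model for c; (ii) under the isomorphism between K(c) and the crossing-model graph Kscr(c), the vertex corresponding to f_{a,D} is v^up[a|D], the principal vertex of the upper subcrystal K^up[a] having deviation D. -/

import Mathlib

open Classical

noncomputable section

/-- Iterate a partial operator `k` times. -/
def optIter {V : Type} (f : V → Option V) : ℕ → V → Option V
  | 0, v => some v
  | k + 1, v => (f v).bind (optIter f k)

/-- A vertex type together with, for every natural number (color) `i`,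
a partial operator whose graph is the set of `i`-edges. -/
structure PreGraph where
  V : Type
  F : ℕ → V → Option V

namespace PreGraph

/-- Partial inverse operator of color `i`. -/
def Finv (K : PreGraph) (i : ℕ) (v : K.V) : Option K.V :=
  if h : ∃ u, K.F i u = some v then some h.choose else none

/-- Number of edges of the maximal `i`-colored path beginning at `v`. -/
def h (K : PreGraph) (i : ℕ) (v : K.V) : ℕ :=
  sSup {k | (optIter (K.F i) k v).isSome = true}

/-- Number of edges of the maximal `i`-colored path ending at `v`. -/
def t (K : PreGraph) (i : ℕ) (v : K.V) : ℕ :=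
  sSup {k | ∃ u, optIter (K.F i) k u = some v}

/-- One (undirected) step along an edge of any color. -/
def Step (K : PreGraph) (u v : K.V) : Prop :=
  ∃ i, K.F i u = some v ∨ K.F i v = some u

/-- Weak connectivity. -/
def Connected (K : PreGraph) : Prop :=
  ∀ u v : K.V, Relation.ReflTransGen K.Step u v

/-- All edges have colors in `C`. -/
def ColorsIn (K : PreGraph) (C : Set ℕ) : Prop :=
  ∀ i ∉ C, ∀ v, K.F i v = none

end PreGraph

/-- `s` has no incoming edges. -/
def IsSource (K : PreGraph) (s : K.V) : Prop := ∀ i u, K.F i u ≠ some s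

/-- `tv` has no outgoing edges. -/
def IsSink (K : PreGraph) (tv : K.V) : Prop := ∀ i, K.F i tv = none

/-- `K` is a (finite) colored graph with colors in `C` satisfying axiom (A1):
every connected monochromatic subgraph is a finite directed path. -/
def IsColored (K : PreGraph) (C : Set ℕ) : Prop :=
  Finite K.V ∧ K.ColorsIn C ∧
  (∀ (i : ℕ) (u u' v : K.V), K.F i u = some v → K.F i u' = some v → u = u') ∧
  (∀ (i : ℕ) (v : K.V) (k : ℕ), 0 < k → optIter (K.F i) k v ≠ some v)

/-- `|i - j| = 1`. -/
def Neighb (i j : ℕ) : Prop := i + 1 = j ∨ j + 1 = i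

/-- `|i - j| ≥ 2`. -/
def Far (i j : ℕ) : Prop := i + 2 ≤ j ∨ j + 2 ≤ i

instance (i j : ℕ) : Decidable (Neighb i j) := by unfold Neighb; infer_instance
instance (i j : ℕ) : Decidable (Far i j) := by unfold Far; infer_instance

/-- Axiom (A2) for the ordered pair of distinct colors `(i, j)`. -/
def A2at (K : PreGraph) (i j : ℕ) : Prop :=
  (∀ u v, K.F i u = some v →
    K.t j v ≤ K.t j u ∧ K.h j u ≤ K.h j v ∧
    ((K.h j u : ℤ) - (K.t j u : ℤ)) - ((K.h j v : ℤ) - (K.t j v : ℤ)) =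
      (if Neighb i j then (-1 : ℤ) else 0)) ∧
  (∀ u v w, K.F i u = some v → K.F i v = some w →
    2 * K.h j v ≤ K.h j u + K.h j w)

/-- Axiom (A3) for neighboring colors `i, j`. -/
def A3at (K : PreGraph) (i j : ℕ) : Prop :=
  (∀ u v v', K.F i u = some v → K.F j u = some v' →
    K.h j v = K.h j u →
    ((K.h i v' : ℤ) - (K.h i u : ℤ) = 1 ∧ ∃ w, K.F j v = some w ∧ K.F i v' = some w)) ∧
  (∀ u u' v, K.F i u = some v → K.F j u' = some v →
    (K.h j v : ℤ) - (K.h j u : ℤ) = 1 →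
    (K.h i v = K.h i u' ∧ ∃ w, K.F j w = some u ∧ K.F i w = some u'))

/-- Axiom (A4) (Verma relations) for neighboring colors `i, j`. -/
def A4at (K : PreGraph) (i j : ℕ) : Prop :=
  (∀ u v v', K.F i u = some v → K.F j u = some v' →
    (K.h j v : ℤ) - (K.h j u : ℤ) = 1 → (K.h i v' : ℤ) - (K.h i u : ℤ) = 1 →
    ∃ w, (((K.F i u).bind (K.F j)).bind (K.F j)).bind (K.F i) = some w ∧
         (((K.F j u).bind (K.F i)).bind (K.F i)).bind (K.F j) = some w) ∧
  (∀ u u' v, K.F i u = some v → K.F j u' = some v →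
    K.h j v = K.h j u → K.h i v = K.h i u' →
    ∃ w, (((K.Finv i v).bind (K.Finv j)).bind (K.Finv j)).bind (K.Finv i) = some w ∧
         (((K.Finv j v).bind (K.Finv i)).bind (K.Finv i)).bind (K.Finv j) = some w)

/-- Axiom (A5) for colors `i, j` at distance at least 2. -/
def A5at (K : PreGraph) (i j : ℕ) : Prop :=
  ∀ Fi ∈ ({K.F i, K.Finv i} : Set (K.V → Option K.V)),
  ∀ Fj ∈ ({K.F j, K.Finv j} : Set (K.V → Option K.V)),
  ∀ v, (Fi v).isSome → (Fj v).isSome →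
    ∃ w, (Fi v).bind Fj = some w ∧ (Fj v).bind Fi = some w

/-- `K` is a regular crystal of type A on the color set `C`
(an `A_{|C|}`-crystal when `C` is an integer interval). -/
def IsCrystalOn (K : PreGraph) (C : Set ℕ) : Prop :=
  IsColored K C ∧ K.Connected ∧
  (∀ i ∈ C, ∀ j ∈ C, i ≠ j → A2at K i j) ∧
  (∀ i ∈ C, ∀ j ∈ C, Neighb i j → A3at K i j ∧ A4at K i j) ∧
  (∀ i ∈ C, ∀ j ∈ C, Far i j → A5at K i j)

/-- `K` is an `A_n`-crystal (colors `1, …, n`). -/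
def IsACrystal (n : ℕ) (K : PreGraph) : Prop := IsCrystalOn K (Set.Icc 1 n)

/-- Apply a list of operators, head first. -/
def applyStr (K : PreGraph) : List ℕ → K.V → Option K.V
  | [], v => some v
  | i :: L, v => (K.F i v).bind (applyStr K L)

/-- The string `w_{m,k,j} = F_{o+j} F_{o+j+1} ⋯ F_{o+j+k-1}` (rightmost applied
first, i.e. head of the list applied first) for a crystal with colors `o+1, …, o+m`. -/
def wStr (o k j : ℕ) : List ℕ := (List.range k).map (fun m => o + j + k - 1 - m)

/-- The string `S_{m,k} = w_{m,k,m-k+1} ⋯ w_{m,k,2} w_{m,k,1}` for a crystal with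
colors `o+1, …, o+m`. -/
def SStr (o m k : ℕ) : List ℕ :=
  (List.range (m - k + 1)).flatMap fun jm => wStr o k (jm + 1)

/-- The string `S_{m,m}^{a_{o+m}} ⋯ S_{m,1}^{a_{o+1}}` for a crystal with colors
`o+1, …, o+m`, defining the principal vertex with coordinates `a`. -/
def prinStr (o m : ℕ) (a : ℕ → ℕ) : List ℕ :=
  (List.range m).flatMap fun km => (List.replicate (a (o + km + 1)) (SStr o m (km + 1))).flatten

def prinOpt (K : PreGraph) (o m : ℕ) (s : K.V) (a : ℕ → ℕ) : Option K.V :=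
  applyStr K (prinStr o m a) s

/-- `p` is the principal vertex with coordinates `a` of the crystal `K` with colors
`o+1, …, o+m` and source `s`. -/
def IsPrin (K : PreGraph) (o m : ℕ) (s : K.V) (a : ℕ → ℕ) (p : K.V) : Prop :=
  prinOpt K o m s a = some p

/-- The principal lattice of an `A_n`-crystal with source `s` and parameter `c`. -/
def PrinLat (K : PreGraph) (n : ℕ) (s : K.V) (c : ℕ → ℕ) : Set K.V :=
  {p | ∃ a : ℕ → ℕ, (∀ i, 1 ≤ i → i ≤ n → a i ≤ c i) ∧ IsPrin K 0 n s a p}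

/-- One undirected step along an edge with color in `I`. -/
def stepOn (K : PreGraph) (I : Set ℕ) (u v : K.V) : Prop :=
  ∃ i ∈ I, K.F i u = some v ∨ K.F i v = some u

/-- `u` lies in the same `I`-colored component as `v`. -/
def inComp (K : PreGraph) (I : Set ℕ) (v u : K.V) : Prop :=
  Relation.ReflTransGen (stepOn K I) v u

/-- The subcrystal of `K` with color set `I` containing `v` (the maximal connected
subgraph through `v` using only colors in `I`). -/
def PreGraph.sub (K : PreGraph) (I : Set ℕ) (v : K.V) : PreGraph where
  V := {u : K.V // inComp K I v u}
  F := fun i u =>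
    if hi : i ∈ I then
      (K.F i u.1).pbind fun w hw =>
        some ⟨w, Relation.ReflTransGen.tail u.2 ⟨i, hi, Or.inl (Option.mem_def.mp hw)⟩⟩
    else none

/-- Directed reachability. -/
def dirReach (K : PreGraph) (u v : K.V) : Prop :=
  Relation.ReflTransGen (fun a b => ∃ i, K.F i a = some b) u v

/-- The interval of `K` from `p` to `q`: the subgraph formed by all vertices and
edges lying on directed paths from `p` to `q`. -/
def PreGraph.interval (K : PreGraph) (p q : K.V) : PreGraph where
  V := {w : K.V // dirReach K p w ∧ dirReach K w q}
  F := fun i u =>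
    (K.F i u.1).pbind fun w _ =>
      if hw : dirReach K p w ∧ dirReach K w q then some ⟨w, hw⟩ else none

/-- The symmetric extract: restriction to self-complementary vertices,
with `ibar`-edges given by `chain i`. -/
def extract (K : PreGraph) (chain : ℕ → K.V → Option K.V) (σ : K.V → K.V) : PreGraph where
  V := {v : K.V // σ v = v}
  F := fun i u =>
    (chain i u.1).pbind fun w _ => if hw : σ w = w then some ⟨w, hw⟩ else none

/-- The operator chain for the color `ibar` of the symmetric extract of a
symmetric `A_{2n-1}`-crystal. -/
def chainB (K : PreGraph) (n : ℕ) (i : ℕ) (u : K.V) : Option K.V :=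
  if 1 ≤ i ∧ i ≤ n then
    (if i = n then K.F n u else (K.F i u).bind (K.F (2 * n - i)))
  else none

/-- The operator chain for the color `ibar` of the symmetric extract of a
symmetric `A_{2n}`-crystal. -/
def chainC (K : PreGraph) (n : ℕ) (i : ℕ) (u : K.V) : Option K.V :=
  if 1 ≤ i ∧ i ≤ n then
    (if i = n then (((K.F n u).bind (K.F (n + 1))).bind (K.F (n + 1))).bind (K.F n)
     else (K.F i u).bind (K.F (2 * n + 1 - i)))
  else none

/-- Symmetric extract from a symmetric `A_{2n-1}`-crystal. -/
def extractB (K : PreGraph) (n : ℕ) (σ : K.V → K.V) : PreGraph := extract K (chainB K n) σ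

/-- Symmetric extract from a symmetric `A_{2n}`-crystal. -/
def extractC (K : PreGraph) (n : ℕ) (σ : K.V → K.V) : PreGraph := extract K (chainC K n) σ

/-- Admissibility of a six-tuple `(x', y, x''; y', x, y'')` in the worm model. -/
def WormOK (g1 g2 : ℕ) : ℤ × ℤ × ℤ × ℤ × ℤ × ℤ → Prop
  | (x', y, x'', y', x, y'') =>
    (0 ≤ x' ∧ x' ≤ 2 * (g1 : ℤ)) ∧ (0 ≤ x'' ∧ x'' ≤ 2 * (g1 : ℤ)) ∧
    (0 ≤ x ∧ x ≤ 2 * (g1 : ℤ)) ∧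
    (0 ≤ y' ∧ y' ≤ (g2 : ℤ)) ∧ (0 ≤ y'' ∧ y'' ≤ (g2 : ℤ)) ∧ (0 ≤ y ∧ y ≤ (g2 : ℤ)) ∧
    (2 ∣ x') ∧ (2 ∣ x'') ∧ (y' ≤ y ∧ y ≤ y'') ∧ (x' ≤ x ∧ x ≤ x'') ∧
    (y' < y → x' = x) ∧ (y < y'' → x = x'')

/-- The candidate image of a worm under the operator `1tilde`. -/
def worm1 : ℤ × ℤ × ℤ × ℤ × ℤ × ℤ → ℤ × ℤ × ℤ × ℤ × ℤ × ℤ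
  | (x', y, x'', y', x, y'') =>
    if 2 * x > x' + x'' then (x' + 2, y, x'', y', x, y'')
    else if x = x' ∧ x' = x'' ∧ y < y'' then (x', y + 1, x'', y', x, y'')
    else (x', y, x'' + 2, y', x, y'')

/-- The candidate image of a worm under the operator `2tilde`. -/
def worm2 : ℤ × ℤ × ℤ × ℤ × ℤ × ℤ → ℤ × ℤ × ℤ × ℤ × ℤ × ℤ
  | (x', y, x'', y', x, y'') =>
    if 2 * y > y' + y'' then (x', y, x'', y' + 1, x, y'')
    else if y' = y ∧ y = y'' ∧ x < x'' then (x', y, x'', y', x + 1, y'')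
    else (x', y, x'', y', x, y'' + 1)

/-- The worm graph `W(g1, g2)`, with colors `1 = 1tilde` and `2 = 2tilde`. -/
def WormGraph (g1 g2 : ℕ) : PreGraph where
  V := {w : ℤ × ℤ × ℤ × ℤ × ℤ × ℤ // WormOK g1 g2 w}
  F := fun i u =>
    if i = 1 then
      (if h1 : WormOK g1 g2 (worm1 u.1) then some ⟨worm1 u.1, h1⟩ else none)
    else if i = 2 then
      (if h2 : WormOK g1 g2 (worm2 u.1) then some ⟨worm2 u.1, h2⟩ else none)
    else none

/-- Isomorphism of colored graphs, renaming colors via `φ`. -/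
def IsoVia (K L : PreGraph) (φ : ℕ → ℕ) : Prop :=
  ∃ e : K.V ≃ L.V, ∀ i u v, K.F i u = some v ↔ L.F (φ i) (e u) = some (e v)

/-- The Cartesian product of an `i`-path of length `p` and a `j`-path of length `q`. -/
def boxGraph (i j p q : ℕ) : PreGraph where
  V := Fin (p + 1) × Fin (q + 1)
  F := fun s u =>
    if s = i then
      (if h : (u.1 : ℕ) < p then some (⟨(u.1 : ℕ) + 1, by omega⟩, u.2) else none)
    else if s = j then
      (if h : (u.2 : ℕ) < q then some (u.1, ⟨(u.2 : ℕ) + 1, by omega⟩) else none)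
    else none

/-- `B_n`-crystal: components with colors `n-1, n` are worm graphs,
with color `n-1` corresponding to `1tilde` and `n` to `2tilde`. -/
def IsBCrystal (n : ℕ) (B : PreGraph) : Prop :=
  IsColored B (Set.Icc 1 n) ∧ B.Connected ∧
  (∀ i ∈ Set.Icc 1 n, ∀ j ∈ Set.Icc 1 n, Far i j → A5at B i j) ∧
  (∀ i j, 1 ≤ i → i < n → 1 ≤ j → j < n → Neighb i j →
    ∀ v : B.V, IsCrystalOn (B.sub {i, j} v) {i, j}) ∧
  (∀ v : B.V, ∃ g1 g2 : ℕ,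
    IsoVia (B.sub ({n - 1, n} : Set ℕ) v) (WormGraph g1 g2)
      (fun x => if x = n - 1 then 1 else if x = n then 2 else 0))

/-- `C_n`-crystal: components with colors `n-1, n` are worm graphs,
with color `n-1` corresponding to `2tilde` and `n` to `1tilde`. -/
def IsCCrystal (n : ℕ) (B : PreGraph) : Prop :=
  IsColored B (Set.Icc 1 n) ∧ B.Connected ∧
  (∀ i ∈ Set.Icc 1 n, ∀ j ∈ Set.Icc 1 n, Far i j → A5at B i j) ∧
  (∀ i j, 1 ≤ i → i < n → 1 ≤ j → j < n → Neighb i j →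
    ∀ v : B.V, IsCrystalOn (B.sub {i, j} v) {i, j}) ∧
  (∀ v : B.V, ∃ g1 g2 : ℕ,
    IsoVia (B.sub ({n - 1, n} : Set ℕ) v) (WormGraph g1 g2)
      (fun x => if x = n - 1 then 2 else if x = n then 1 else 0))

/-! ### The crossing model -/

/-- `(k, i, j)` is a node `v_i^k(j)` of the supporting graph `G` for rank `n`. -/
def isNode (n k i j : ℕ) : Prop :=
  1 ≤ j ∧ j ≤ i ∧ i ≤ n ∧ i - j + 1 ≤ k ∧ k ≤ n - j + 1

instance (n k i j : ℕ) : Decidable (isNode n k i j) := by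
  unfold isNode; infer_instance

/-- Extension of a function on the nodes of `G` to the extended supporting graph:
extra nodes from which `G^k` is reachable get value `c k`, the others get `0`. -/
def fext (n : ℕ) (c : ℕ → ℕ) (f : ℕ × ℕ × ℕ → ℤ) (k i j : ℕ) : ℤ :=
  if isNode n k i j then f (k, i, j)
  else if j ≤ n - k + 1 then (c k : ℤ) else 0

/-- The slack at the node `v_i^k(j)`. -/
def epsN (n : ℕ) (c : ℕ → ℕ) (f : ℕ × ℕ × ℕ → ℤ) (k i j : ℕ) : ℤ :=
  (fext n c f k (i - 1) (j - 1) - fext n c f k i j) -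
    (fext n c f k i (j - 1) - fext n c f k (i + 1) j)

/-- The total slack at the multinode `V_i(j)`. -/
def epsTot (n : ℕ) (c : ℕ → ℕ) (f : ℕ × ℕ × ℕ → ℤ) (i j : ℕ) : ℤ :=
  ∑ k ∈ Finset.Icc (i - j + 1) (n - j + 1), epsN n c f k i j

/-- The reduced slack at the multinode `V_i(j)`. -/
def teps (n : ℕ) (c : ℕ → ℕ) (f : ℕ × ℕ × ℕ → ℤ) (i j : ℕ) : ℤ :=
  if hj : (Finset.Icc 1 j).Nonempty then
    max 0 ((Finset.Icc 1 j).inf' hj fun p => ∑ q ∈ Finset.Icc p j, epsTot n c f i q)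
  else 0

/-- `k0` satisfies the switch condition in the multinode `V_i(j)`. -/
def switchCond (n : ℕ) (f : ℕ × ℕ × ℕ → ℤ) (i j k0 : ℕ) : Prop :=
  i - j + 1 ≤ k0 ∧ k0 ≤ n - j + 1 ∧
  (∀ k, i - j + 1 ≤ k → k < k0 → isNode n k (i + 1) (j + 1) →
    f (k, i, j) = f (k, i + 1, j + 1)) ∧
  (∀ k, k0 < k → k ≤ n - j + 1 → isNode n k (i + 1) j →
    f (k, i + 1, j) = f (k, i, j))

/-- The switch-node (first node with the switch property) of the multinode `V_i(j)`. -/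
def switchNode (n : ℕ) (f : ℕ × ℕ × ℕ → ℤ) (i j : ℕ) : ℕ :=
  sInf {k0 | switchCond n f i j k0}

/-- Feasible functions of the crossing model (normalized to vanish off the nodes). -/
def Feasible (n : ℕ) (c : ℕ → ℕ) (f : ℕ × ℕ × ℕ → ℤ) : Prop :=
  (∀ k i j, ¬ isNode n k i j → f (k, i, j) = 0) ∧
  (∀ k i j, isNode n k i j → isNode n k (i - 1) j → f (k, i - 1, j) ≤ f (k, i, j)) ∧
  (∀ k i j, isNode n k i j → isNode n k (i + 1) (j + 1) → f (k, i + 1, j + 1) ≤ f (k, i, j)) ∧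
  (∀ k i j, isNode n k i j → 0 ≤ f (k, i, j) ∧ f (k, i, j) ≤ (c k : ℤ)) ∧
  (∀ i j, 1 ≤ j → j ≤ i → i ≤ n → ∃ k0, switchCond n f i j k0)

/-- Increase `f` by one at the node `(k, i, j)`. -/
def bump (f : ℕ × ℕ × ℕ → ℤ) (k i j : ℕ) : ℕ × ℕ × ℕ → ℤ :=
  fun x => if x = (k, i, j) then f x + 1 else f x

/-- The crossing-model graph `Kscr(c)`: vertices are the feasible functions, and
the move `φ_i` increases `f` by one at the switch-node of the active multinode. -/
def Kscr (n : ℕ) (c : ℕ → ℕ) : PreGraph where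
  V := {f : ℕ × ℕ × ℕ → ℤ // Feasible n c f}
  F := fun i f =>
    if 1 ≤ i ∧ i ≤ n ∧ ∃ j, 1 ≤ j ∧ j ≤ i ∧ 0 < teps n c f.1 i j then
      (let j := sSup {j | 1 ≤ j ∧ j ≤ i ∧ 0 < teps n c f.1 i j}
       let g := bump f.1 (switchNode n f.1 i j) i j
       if hg : Feasible n c g then some ⟨g, hg⟩ else none)
    else none

/-- The function `f_{a,D}` of the crossing model. -/
def faD (n : ℕ) (a : ℕ → ℕ) (D : ℕ → ℤ) : ℕ × ℕ × ℕ → ℤ := fun x =>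
  if isNode n x.1 x.2.1 x.2.2 then
    (if x.2.1 - x.2.2 + 1 = x.1 then (a x.1 : ℤ) else (a x.1 : ℤ) + min (D (x.1 - 1)) 0) +
    (if x.2.2 ≤ n - x.1 then max (D x.1) 0 else 0)
  else 0

/-! ### Descriptions of self-complementary vertices -/

/-- `(a1, a2, δ, l)` is the description of a self-complementary vertex `v` of a
symmetric `A_3`-crystal `K` with source `s` and parameter `c`. -/
def IsDescB (K : PreGraph) (s : K.V) (c : ℕ → ℕ) (v : K.V) (q : ℕ × ℕ × ℤ × ℕ) : Prop :=
  q.2.2.2 = K.t 2 v ∧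
  ∃ (a : ℕ → ℕ) (pa : K.V),
    a 1 = q.1 ∧ a 2 = q.2.1 ∧ a 3 = ((q.1 : ℤ) + max q.2.2.1 0).toNat ∧
    (∀ i, 1 ≤ i → i ≤ 3 → a i ≤ c i) ∧
    IsPrin K 0 3 s a pa ∧ inComp K (Set.Icc 1 2) pa v ∧
    0 ≤ (q.2.1 : ℤ) + q.2.2.1 ∧ 0 ≤ (a 3 : ℤ) - q.2.2.1 ∧
    ∃ s' : (K.sub (Set.Icc 1 2) pa).V, IsSource (K.sub (Set.Icc 1 2) pa) s' ∧
    ∃ z : (K.sub (Set.Icc 1 2) pa).V,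
      IsPrin (K.sub (Set.Icc 1 2) pa) 0 2 s'
        (fun i => if i = 1 then ((q.2.1 : ℤ) + q.2.2.1).toNat else ((a 3 : ℤ) - q.2.2.1).toNat) z ∧
      inComp K ({2} : Set ℕ) z.1 v

/-- The polytope of descriptions for a symmetric `A_3`-crystal with parameter `(c1, c2, c1)`. -/
def QuadB (c1 c2 : ℕ) : Set (ℕ × ℕ × ℤ × ℕ) :=
  {q | q.1 ≤ c1 ∧ q.2.1 ≤ c2 ∧ -(q.2.1 : ℤ) ≤ q.2.2.1 ∧ (q.2.1 : ℤ) - (c2 : ℤ) ≤ q.2.2.1 ∧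
       q.2.2.1 ≤ (c1 : ℤ) - (q.1 : ℤ) ∧ (q.2.2.2 : ℤ) ≤ (c2 : ℤ) + 2 * q.2.2.1}

/-- The worm associated to the description `(a1, a2, δ, l)`. -/
def wtupleB (a1 a2 : ℕ) (δ : ℤ) (l : ℕ) : ℤ × ℤ × ℤ × ℤ × ℤ × ℤ :=
  let a3 : ℤ := (a1 : ℤ) + max δ 0
  let tr : ℤ × ℤ × ℤ :=
    if 0 ≤ δ then
      if (l : ℤ) ≤ (a2 : ℤ) then ((l : ℤ), 2 * (a1 : ℤ), (a2 : ℤ))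
      else if (l : ℤ) ≤ (a2 : ℤ) + 2 * δ then
        ((a2 : ℤ), 2 * (a1 : ℤ) + (l : ℤ) - (a2 : ℤ), (a2 : ℤ))
      else ((a2 : ℤ), 2 * a3, (l : ℤ) - 2 * δ)
    else
      if (l : ℤ) ≤ (a2 : ℤ) + δ then ((l : ℤ), 2 * (a1 : ℤ), (a2 : ℤ) - δ)
      else ((a2 : ℤ) + δ, 2 * (a1 : ℤ), (l : ℤ) - 2 * δ)
  (2 * (a1 : ℤ), (a2 : ℤ), 2 * a3, tr.1, tr.2.1, tr.2.2)

def wtQ (q : ℕ × ℕ × ℤ × ℕ) : ℤ × ℤ × ℤ × ℤ × ℤ × ℤ :=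
  wtupleB q.1 q.2.1 q.2.2.1 q.2.2.2

/-- The string `(F_2 F_3)^r (F_3 F_2)^r` (rightmost applied first). -/
def diagStr (r : ℕ) : List ℕ :=
  (List.replicate r ([2, 3] : List ℕ)).flatten ++ (List.replicate r ([3, 2] : List ℕ)).flatten

/-- `(a1, a2, δ, ρ)` is the description of a self-complementary vertex `v` of a
symmetric `A_4`-crystal `K` with source `s` and parameter `c`. -/
def IsDescC (K : PreGraph) (s : K.V) (c : ℕ → ℕ) (v : K.V) (q : ℕ × ℕ × ℤ × ℕ) : Prop :=
  ∃ (a : ℕ → ℕ) (pa : K.V),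
    a 1 = q.1 ∧ a 2 = q.2.1 ∧ a 3 = ((q.2.1 : ℤ) + min q.2.2.1 0).toNat ∧
    a 4 = ((q.1 : ℤ) + max q.2.2.1 0).toNat ∧
    (∀ i, 1 ≤ i → i ≤ 4 → a i ≤ c i) ∧
    IsPrin K 0 4 s a pa ∧ inComp K (Set.Icc 1 3) pa v ∧
    0 ≤ (q.2.1 : ℤ) + q.2.2.1 ∧ 0 ≤ (a 4 : ℤ) - q.2.2.1 ∧
    (∃ s' : (K.sub (Set.Icc 1 3) pa).V, IsSource (K.sub (Set.Icc 1 3) pa) s' ∧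
     ∃ z : (K.sub (Set.Icc 1 3) pa).V,
       IsPrin (K.sub (Set.Icc 1 3) pa) 0 3 s'
         (fun i => if i = 1 then ((q.2.1 : ℤ) + q.2.2.1).toNat
                   else if i = 2 then a 3 else ((a 4 : ℤ) - q.2.2.1).toNat) z ∧
       inComp K (Set.Icc 2 3) z.1 v) ∧
    (∃ stil : (K.sub (Set.Icc 2 3) v).V, IsSource (K.sub (Set.Icc 2 3) v) stil ∧
       applyStr (K.sub (Set.Icc 2 3) v) (diagStr q.2.2.2) stil =
         some ⟨v, Relation.ReflTransGen.refl⟩)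

/-- The polytope of descriptions for a symmetric `A_4`-crystal with parameter
`(c1, c2, c2, c1)`. -/
def QuadC (c1 c2 : ℕ) : Set (ℕ × ℕ × ℤ × ℕ) :=
  {q | q.1 ≤ c1 ∧ q.2.1 ≤ c2 ∧ -(q.2.1 : ℤ) ≤ q.2.2.1 ∧
       q.2.2.1 ≤ (c1 : ℤ) - (q.1 : ℤ) ∧ (q.2.2.2 : ℤ) ≤ (c2 : ℤ) + q.2.2.1}

end

/-! ### Moves of the crossing model along rectangles -/

/-- Indicator of the first `j - 1` columns, and of the part of column `j` above row `m`,
of the block of height `M` in the component `G^k` (rows are numbered by `i - j + 1`). -/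
def stairInd (k M j m : ℕ) (κ i q : ℕ) : ℤ :=
  if κ = k ∧ 1 ≤ q ∧ q ≤ i ∧ i < q + M ∧ (q < j ∨ (q = j ∧ m + j ≤ i)) then 1 else 0

/-- Increase `f` by one on a staircase. -/
def stair (f : ℕ × ℕ × ℕ → ℤ) (k M j m : ℕ) : ℕ × ℕ × ℕ → ℤ := fun x =>
  f x + stairInd k M j m x.1 x.2.1 x.2.2

lemma stair_initial (f : ℕ × ℕ × ℕ → ℤ) (k M : ℕ) : stair f k M 1 M = f := by
  funext ⟨κ, i, q⟩
  simp only [stair, stairInd]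
  rw [if_neg (by omega), add_zero]

lemma stair_next_column (f : ℕ × ℕ × ℕ → ℤ) (k M j : ℕ) :
    stair f k M (j + 1) M = stair f k M j 0 := by
  funext ⟨κ, i, q⟩
  simp only [stair, stairInd]
  congr 1
  refine if_congr ?_ rfl rfl
  omega

lemma bump_stair (f : ℕ × ℕ × ℕ → ℤ) (k M j m : ℕ) (hj : 1 ≤ j) (hm : m + 1 ≤ M) :
    bump (stair f k M j (m + 1)) k (m + j) j = stair f k M j m := by
  funext ⟨κ, i, q⟩
  simp only [bump, stair, stairInd, Prod.mk.injEq]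
  split_ifs <;> omega

lemma fext_stair {n : ℕ} (c : ℕ → ℕ) (f : ℕ × ℕ × ℕ → ℤ) {k M j : ℕ} (m κ i q : ℕ)
    (hk : k ≤ n) (hM : M ≤ k) (hj : j ≤ n - k + 1) :
    fext n c (stair f k M j m) κ i q = fext n c f κ i q + stairInd k M j m κ i q := by
  unfold fext
  by_cases h : isNode n κ i q
  · simp only [if_pos h, stair]
  · rw [if_neg h, if_neg h]
    unfold isNode at h
    have h0 : stairInd k M j m κ i q = 0 := if_neg (by omega)
    rw [h0, add_zero]

/-- The variation of the slack caused by a staircase. -/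
def stairSlack (k M j m i q : ℕ) : ℤ :=
  stairInd k M j m k (i - 1) (q - 1) - stairInd k M j m k i q -
    (stairInd k M j m k i (q - 1) - stairInd k M j m k (i + 1) q)

lemma epsTot_stair {n : ℕ} (c : ℕ → ℕ) (f : ℕ × ℕ × ℕ → ℤ) {k M j : ℕ} (m i q : ℕ)
    (hk : k ≤ n) (hM : M ≤ k) (hj : j ≤ n - k + 1) :
    epsTot n c (stair f k M j m) i q = epsTot n c f i q +
      if k ∈ Finset.Icc (i - q + 1) (n - q + 1) then stairSlack k M j m i q else 0 := by
  unfold epsTot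
  rw [← Finset.sum_ite_eq' (Finset.Icc (i - q + 1) (n - q + 1)) k
    (fun _ => stairSlack k M j m i q), ← Finset.sum_add_distrib]
  refine Finset.sum_congr rfl fun κ _ => ?_
  simp only [epsN, fext_stair c f m _ _ _ hk hM hj]
  by_cases h : κ = k
  · subst h
    simp only [stairSlack, if_true]
    ring
  · simp only [stairInd, h, false_and, if_false]
    ring

lemma teps_pos {n : ℕ} {c : ℕ → ℕ} {f : ℕ × ℕ × ℕ → ℤ} {i j : ℕ} (hj : 1 ≤ j)
    (hlt : ∀ q, 1 ≤ q → q < j → 0 ≤ epsTot n c f i q) (heq : 0 < epsTot n c f i j) :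
    0 < teps n c f i j := by
  have hne : (Finset.Icc 1 j).Nonempty := Finset.nonempty_Icc.mpr hj
  rw [teps, dif_pos hne]
  refine lt_max_of_lt_right ((Finset.lt_inf'_iff hne).mpr fun p hp => ?_)
  rw [Finset.mem_Icc] at hp
  refine Finset.sum_pos' (fun q hq => ?_) ⟨j, Finset.mem_Icc.mpr ⟨hp.2, le_rfl⟩, heq⟩
  rw [Finset.mem_Icc] at hq
  rcases hq.2.lt_or_eq with h | h
  · exact hlt q (by omega) h
  · exact h ▸ heq.le

lemma teps_nonpos {n : ℕ} {c : ℕ → ℕ} {f : ℕ × ℕ × ℕ → ℤ} {i j : ℕ} (hj : 1 ≤ j)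
    (h : epsTot n c f i j ≤ 0) : teps n c f i j ≤ 0 := by
  have hne : (Finset.Icc 1 j).Nonempty := Finset.nonempty_Icc.mpr hj
  rw [teps, dif_pos hne]
  refine max_le le_rfl ?_
  refine (Finset.inf'_le _ (Finset.mem_Icc.mpr ⟨hj, le_rfl⟩)).trans ?_
  simpa using h

/-- The color `i` move acts at node `(k, i, j)` as soon as the total slacks of `V_i(q)` are
nonnegative for `q < j`, positive for `q = j`, nonpositive for `q > j`, and `k` is the
switch-node of `V_i(j)`. -/
lemma Kscr_move {n : ℕ} {c : ℕ → ℕ} {f : ℕ × ℕ × ℕ → ℤ} (hf : Feasible n c f)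
    {i j k : ℕ} (hj : 1 ≤ j) (hji : j ≤ i) (hin : i ≤ n)
    (hlt : ∀ q, 1 ≤ q → q < j → 0 ≤ epsTot n c f i q) (heq : 0 < epsTot n c f i j)
    (hgt : ∀ q, j < q → q ≤ i → epsTot n c f i q ≤ 0)
    (hsw : switchCond n f i j k)
    (hfirst : k = i - j + 1 ∨ (isNode n k (i + 1) j ∧ f (k, i + 1, j) ≠ f (k, i, j)))
    (hg : Feasible n c (bump f k i j)) :
    (Kscr n c).F i ⟨f, hf⟩ = some ⟨bump f k i j, hg⟩ := by
  have hpos := teps_pos hj hlt heq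
  have hsup : sSup {j | 1 ≤ j ∧ j ≤ i ∧ 0 < teps n c f i j} = j := by
    refine IsGreatest.csSup_eq ⟨⟨hj, hji, hpos⟩, fun q hq => ?_⟩
    by_contra hcon
    exact absurd hq.2.2 (not_lt.mpr (teps_nonpos hq.1 (hgt q (by omega) hq.2.1)))
  have hnode : switchNode n f i j = k := by
    refine IsLeast.csInf_eq ⟨hsw, fun k' hk' => ?_⟩
    by_contra hcon
    have hk'' : switchCond n f i j k' := hk'
    rcases hfirst with h | ⟨h, hne⟩
    · have := hk''.1
      omega
    · exact hne (hk''.2.2.2 k (by omega) hsw.2.1 h)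
  have hcond : 1 ≤ i ∧ i ≤ n ∧ ∃ j, 1 ≤ j ∧ j ≤ i ∧ 0 < teps n c f i j :=
    ⟨by omega, hin, j, hj, hji, hpos⟩
  simp only [Kscr, if_pos hcond, hsup, hnode, dif_pos hg]

/-- In the crossing model, the string `L` takes `f` to `g`. -/
def KscrPath (n : ℕ) (c : ℕ → ℕ) (L : List ℕ) (f g : ℕ × ℕ × ℕ → ℤ) : Prop :=
  ∃ (hf : Feasible n c f) (hg : Feasible n c g),
    applyStr (Kscr n c) L ⟨f, hf⟩ = some ⟨g, hg⟩

lemma applyStr_append (K : PreGraph) (L L' : List ℕ) (v : K.V) :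
    applyStr K (L ++ L') v = (applyStr K L v).bind (applyStr K L') := by
  induction L generalizing v with
  | nil => rfl
  | cons i L ih =>
    simp only [List.cons_append, applyStr]
    cases K.F i v with
    | none => rfl
    | some w => exact ih w

namespace KscrPath

variable {n : ℕ} {c : ℕ → ℕ} {f g h : ℕ × ℕ × ℕ → ℤ} {L L' : List ℕ}

lemma nil (hf : Feasible n c f) : KscrPath n c [] f f := ⟨hf, hf, rfl⟩

lemma append (hfg : KscrPath n c L f g) (hgh : KscrPath n c L' g h) :
    KscrPath n c (L ++ L') f h := by
  obtain ⟨hf, hg, e⟩ := hfg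
  obtain ⟨_, hh, e'⟩ := hgh
  exact ⟨hf, hh, (applyStr_append (Kscr n c) L L' ⟨f, hf⟩).trans <| by
    rw [e]; exact e'⟩

/-- Concatenation of paths indexed by an initial segment. -/
lemma flatMap_range (w : ℕ → List ℕ) (φ : ℕ → ℕ × ℕ × ℕ → ℤ) (N : ℕ)
    (h0 : Feasible n c (φ 0)) (hw : ∀ t < N, KscrPath n c (w t) (φ t) (φ (t + 1))) :
    KscrPath n c ((List.range N).flatMap w) (φ 0) (φ N) := by
  induction N with
  | zero => exact nil h0
  | succ N ih =>
    rw [List.range_succ, List.flatMap_append]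
    refine append (ih fun t ht => hw t (by omega)) ?_
    simpa using hw N (by omega)

end KscrPath

/-- Conditions on `f` guaranteeing that the string going through the block of height `M` and
width `J` of the component `G^k` increases `f` by one exactly on this block. -/
structure IsBlock (n : ℕ) (c : ℕ → ℕ) (f : ℕ × ℕ × ℕ → ℤ) (k M J : ℕ) : Prop where
  one_le : 1 ≤ M
  height : M ≤ k
  le_rank : k ≤ n
  width : J ≤ n - k + 1
  feasible : ∀ j m, 1 ≤ j → j ≤ J → m ≤ M → Feasible n c (stair f k M j m)
  switch : ∀ j m, 1 ≤ j → j ≤ J → 1 ≤ m → m ≤ M →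
    switchCond n (stair f k M j m) (m + j - 1) j k
  top : ∀ j, 1 ≤ j → j ≤ J → k = M ∨ f (k, M + j, j) ≠ f (k, M + j - 1, j)
  mono : ∀ j m, 1 ≤ j → j ≤ J → 1 ≤ m → m < M → f (k, m + j - 1, j) ≤ f (k, m + j, j)
  slack_eq_zero : ∀ i q, 2 ≤ q → q ≤ i → i < M + J → epsTot n c f i q = 0
  slack_nonneg : ∀ i, 1 ≤ i → i < M + J → 0 ≤ epsTot n c f i 1
  slack_pos : 0 < epsTot n c f M 1

namespace IsBlock

variable {n : ℕ} {c : ℕ → ℕ} {f : ℕ × ℕ × ℕ → ℤ} {k M J : ℕ}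

lemma step (H : IsBlock n c f k M J) {j m : ℕ} (hj : 1 ≤ j) (hjJ : j ≤ J) (hm : m + 1 ≤ M) :
    KscrPath n c [m + j] (stair f k M j (m + 1)) (stair f k M j m) := by
  have h1 := H.one_le
  have h2 := H.height
  have h3 := H.le_rank
  have h4 := H.width
  have hf := H.feasible j (m + 1) hj hjJ hm
  have hb := bump_stair f k M j m hj hm
  have hg : Feasible n c (bump (stair f k M j (m + 1)) k (m + j) j) := by
    rw [hb]; exact H.feasible j m hj hjJ (by omega)
  have hsw := H.switch j (m + 1) hj hjJ (by omega) hm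
  rw [show m + 1 + j - 1 = m + j by omega] at hsw
  have key : (Kscr n c).F (m + j) ⟨_, hf⟩ = some ⟨_, hg⟩ := by
    refine Kscr_move hf hj (by omega) (by omega) ?_ ?_ ?_ hsw ?_ hg
    · intro q hq hqj
      rw [epsTot_stair c f (m + 1) (m + j) q h3 h2 (by omega)]
      rcases hq.lt_or_eq with hq2 | hq1
      · rw [H.slack_eq_zero _ q hq2 (by omega) (by omega)]
        simp only [stairSlack, stairInd, true_and]
        split_ifs <;> omega
      · subst hq1
        have a1 := H.slack_nonneg (m + j) (by omega) (by omega)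
        by_cases hM : m + j = M
        · have a2 := H.slack_pos
          rw [hM]
          simp only [stairSlack, stairInd, true_and]
          split_ifs <;> omega
        · simp only [stairSlack, stairInd, true_and]
          split_ifs <;> omega
    · rw [epsTot_stair c f (m + 1) (m + j) j h3 h2 (by omega),
        if_pos (Finset.mem_Icc.mpr (by omega))]
      rcases hj.lt_or_eq with hj2 | hj1
      · rw [H.slack_eq_zero _ j hj2 (by omega) (by omega)]
        simp only [stairSlack, stairInd, true_and]
        split_ifs <;> omega
      · subst hj1
        have a1 := H.slack_nonneg (m + 1) (by omega) (by omega)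
        by_cases hM : m + 1 = M
        · have a2 := H.slack_pos
          rw [hM]
          simp only [stairSlack, stairInd, true_and]
          split_ifs <;> omega
        · simp only [stairSlack, stairInd, true_and]
          split_ifs <;> omega
    · intro q hq hqi
      rw [epsTot_stair c f (m + 1) (m + j) q h3 h2 (by omega),
        H.slack_eq_zero _ q (by omega) (by omega) (by omega)]
      simp only [stairSlack, stairInd, true_and]
      split_ifs <;> omega
    · rcases (show m + 1 = M ∨ m + 1 < M by omega) with hM | hM
      · rcases H.top j hj hjJ with h | h
        · left; omega
        · by_cases hk : k = M
          · left; omega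
          right
          refine ⟨⟨by omega, by omega, by omega, by omega, by omega⟩, ?_⟩
          subst hM
          rw [show m + 1 + j - 1 = m + j by omega, show m + 1 + j = m + j + 1 by omega] at h
          simp only [stair, stairInd]
          rw [if_neg (by omega), if_neg (by omega)]
          simpa using h
      · right
        refine ⟨⟨by omega, by omega, by omega, by omega, by omega⟩, ?_⟩
        have := H.mono j (m + 1) hj hjJ (by omega) hM
        rw [show m + 1 + j - 1 = m + j by omega, show m + 1 + j = m + j + 1 by omega] at this
        simp only [stair, stairInd, true_and]
        rw [if_pos (by omega), if_neg (by omega)]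
        omega
  exact hb ▸ ⟨hf, hg, congrArg (Option.bind · (applyStr (Kscr n c) [])) key⟩

lemma column (H : IsBlock n c f k M J) {j : ℕ} (hj : 1 ≤ j) (hjJ : j ≤ J) :
    KscrPath n c (wStr 0 M j) (stair f k M j M) (stair f k M (j + 1) M) := by
  have := KscrPath.flatMap_range (n := n) (c := c) (fun t => [0 + j + M - 1 - t])
    (fun t => stair f k M j (M - t)) M (H.feasible j M hj hjJ le_rfl) (fun t ht => by
      have := H.step (m := M - t - 1) hj hjJ (by omega)
      rwa [show M - t - 1 + j = 0 + j + M - 1 - t by omega,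
        show M - t - 1 + 1 = M - t by omega] at this)
  rw [stair_next_column, wStr, List.map_eq_flatMap]
  simpa using this

lemma path (H : IsBlock n c f k M J) (hJ : 1 ≤ J) {N : ℕ} (hN : N + 1 = M + J) :
    KscrPath n c (SStr 0 N M) f (stair f k M (J + 1) M) := by
  have h0 := H.feasible 1 M le_rfl hJ le_rfl
  have := KscrPath.flatMap_range (n := n) (c := c) (fun t => wStr 0 M (t + 1))
    (fun t => stair f k M (t + 1) M) J h0 (fun t ht => H.column (by omega) (by omega))
  rw [SStr, show N - M + 1 = J by omega]
  simpa only [zero_add, stair_initial] using this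

end IsBlock

/-! ### The functions `f_{a,D}` -/

/-- Admissible pairs: `0 ≤ a ≤ c` and `-a_{k+1} ≤ D_k ≤ c_k - a_k`. -/
structure Admissible (n : ℕ) (c a : ℕ → ℕ) (D : ℕ → ℤ) : Prop where
  le_param : ∀ k, 1 ≤ k → k ≤ n → a k ≤ c k
  neg_le : ∀ k, 1 ≤ k → k ≤ n - 1 → -(a (k + 1) : ℤ) ≤ D k
  le_sub : ∀ k, 1 ≤ k → k ≤ n - 1 → D k ≤ (c k : ℤ) - (a k : ℤ)

lemma faD_of_node {n k i j : ℕ} (a : ℕ → ℕ) (D : ℕ → ℤ) (h : isNode n k i j) :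
    faD n a D (k, i, j) =
      (if i - j + 1 = k then (a k : ℤ) else (a k : ℤ) + min (D (k - 1)) 0) +
      (if j ≤ n - k then max (D k) 0 else 0) :=
  if_pos h

lemma faD_of_not_node {n k i j : ℕ} (a : ℕ → ℕ) (D : ℕ → ℤ) (h : ¬ isNode n k i j) :
    faD n a D (k, i, j) = 0 :=
  if_neg h

lemma exists_switchCond_faD {n : ℕ} (a : ℕ → ℕ) (D : ℕ → ℤ) {i j : ℕ} (hj : 1 ≤ j)
    (hji : j ≤ i) (hin : i ≤ n) : ∃ k, switchCond n (faD n a D) i j k := by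
  by_cases h : D (i - j + 1) < 0 ∧ i - j + 2 ≤ n - j + 1
  · refine ⟨i - j + 2, by omega, by omega, fun k h1 h2 h3 => ?_, fun k h1 h2 h3 => ?_⟩
    · have hk : k = i - j + 1 := by omega
      subst hk
      rw [faD_of_node a D h3, faD_of_node a D (by unfold isNode at *; omega)]
      split_ifs <;> omega
    · rw [faD_of_node a D h3, faD_of_node a D (by unfold isNode at *; omega)]
      split_ifs <;> omega
  · refine ⟨i - j + 1, by omega, by omega, fun k h1 h2 h3 => by omega, fun k h1 h2 h3 => ?_⟩
    rw [faD_of_node a D h3, faD_of_node a D (by unfold isNode at *; omega)]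
    by_cases hk : k - 1 = i - j + 1
    · rw [hk]
      split_ifs <;> omega
    · split_ifs <;> omega

/-- The data `k, M, J` describe one of the blocks on which the operator string `S_{N,M}`,
`N = M + J - 1`, increases `f_{a,D}`: the string of rank `n - 1` modifies `G^M` or `G^{M+1}`
depending on the sign of `D_M`, and the string of rank `n` modifies the whole of `G^M`. -/
def BlockData (n : ℕ) (c a : ℕ → ℕ) (D : ℕ → ℤ) (k M J : ℕ) : Prop :=
  (k = M ∧ M < n ∧ J = n - M ∧ 0 ≤ D M ∧ D M < (c M : ℤ) - (a M : ℤ)) ∨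
  (k = M + 1 ∧ M < n ∧ J = n - M ∧ D M < 0) ∨
  (k = M ∧ M ≤ n ∧ J = n - M + 1 ∧ (∀ l, D l = 0) ∧ a M < c M)

section Block

variable {n : ℕ} {c a : ℕ → ℕ} {D : ℕ → ℤ} {k M J : ℕ}

lemma BlockData.switchCond (B : BlockData n c a D k M J) {g : ℕ × ℕ × ℕ → ℤ}
    (hg : ∀ κ i q, κ ≠ k → g (κ, i, q) = faD n a D (κ, i, q)) {i j : ℕ} (hj : 1 ≤ j)
    (hji : j ≤ i) (hjJ : j ≤ J) (him : i < j + M) :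
    switchCond n g i j k := by
  refine ⟨by unfold BlockData at B; omega, by unfold BlockData at B; omega,
    fun κ h1 h2 h3 => ?_, fun κ h1 h2 h3 => ?_⟩
  · rw [hg κ _ _ (by omega), hg κ _ _ (by omega), faD_of_node a D h3,
      faD_of_node a D (by unfold isNode at *; omega)]
    rcases B with ⟨rfl, B⟩ | ⟨rfl, B⟩ | ⟨rfl, B⟩
    · split_ifs <;> omega
    · by_cases hκ : κ = M
      · subst hκ
        split_ifs <;> omega
      · split_ifs <;> omega
    · have e := B.2.2.1 κ
      split_ifs <;> omega
  · rw [hg κ _ _ (by omega), hg κ _ _ (by omega), faD_of_node a D h3,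
      faD_of_node a D (by unfold isNode at *; omega)]
    rcases B with ⟨rfl, B⟩ | ⟨rfl, B⟩ | ⟨rfl, B⟩
    · by_cases hκ : κ - 1 = k
      · rw [hκ]
        split_ifs <;> omega
      · split_ifs <;> omega
    · split_ifs <;> omega
    · have e := B.2.2.1 (κ - 1)
      split_ifs <;> omega

lemma faD_mono_ascending (a : ℕ → ℕ) (D : ℕ → ℤ) {κ i j : ℕ} (h : isNode n κ i j)
    (h' : isNode n κ (i - 1) j) : faD n a D (κ, i - 1, j) ≤ faD n a D (κ, i, j) := by
  rw [faD_of_node a D h, faD_of_node a D h']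
  unfold isNode at *
  split_ifs <;> omega

lemma faD_mono_descending (a : ℕ → ℕ) (D : ℕ → ℤ) {κ i j : ℕ} (h : isNode n κ i j)
    (h' : isNode n κ (i + 1) (j + 1)) :
    faD n a D (κ, i + 1, j + 1) ≤ faD n a D (κ, i, j) := by
  rw [faD_of_node a D h, faD_of_node a D h']
  unfold isNode at *
  split_ifs <;> omega

lemma Admissible.bounds (A : Admissible n c a D) {κ i j : ℕ} (h : isNode n κ i j) :
    0 ≤ faD n a D (κ, i, j) ∧ faD n a D (κ, i, j) ≤ c κ := by
  rw [faD_of_node a D h]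
  have h1 := A.le_param κ
  have h2 := A.neg_le (κ - 1)
  have h3 := A.le_sub κ
  unfold isNode at h
  rw [show κ - 1 + 1 = κ by omega] at h2
  split_ifs <;> omega

/-- `f_{a,D}` is feasible. -/
lemma Admissible.feasible (A : Admissible n c a D) : Feasible n c (faD n a D) :=
  ⟨fun _ _ _ h => faD_of_not_node a D h, fun _ _ _ h h' => faD_mono_ascending a D h h',
    fun _ _ _ h h' => faD_mono_descending a D h h', fun _ _ _ h => A.bounds h,
    fun _ _ hj hji hin => exists_switchCond_faD a D hj hji hin⟩

lemma Admissible.feasible_stair (A : Admissible n c a D) (B : BlockData n c a D k M J)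
    (j m : ℕ) (hjJ : j ≤ J) : Feasible n c (stair (faD n a D) k M j m) := by
  refine ⟨fun κ i q h => ?_, fun κ i q h h' => ?_, fun κ i q h h' => ?_, fun κ i q h => ?_,
    fun i q hq hqi hin => ?_⟩
  · have h0 : stairInd k M j m κ i q = 0 := if_neg (by unfold isNode BlockData at *; omega)
    simp only [stair, faD_of_not_node a D h, h0, add_zero]
  · have h1 := faD_mono_ascending a D h h'
    by_cases hc : κ = k ∧ i = q + M
    · obtain ⟨rfl, rfl⟩ := hc
      rw [faD_of_node a D h, faD_of_node a D h'] at h1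
      simp only [stair, stairInd, faD_of_node a D h, faD_of_node a D h']
      unfold isNode at *
      rcases B with ⟨rfl, B⟩ | ⟨rfl, B⟩ | ⟨rfl, B⟩
      · omega
      · rw [show M + 1 - 1 = M by omega]
        split_ifs <;> omega
      · omega
    · unfold isNode at *
      simp only [stair, stairInd]
      split_ifs <;> omega
  · have h1 := faD_mono_descending a D h h'
    unfold isNode at h
    simp only [stair, stairInd]
    split_ifs <;> omega
  · have h1 := A.bounds h
    by_cases hc : κ = k ∧ i < q + M
    · obtain ⟨rfl, h2⟩ := hc
      rw [faD_of_node a D h] at h1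
      simp only [stair, stairInd, faD_of_node a D h]
      have h3 := A.le_param κ
      have h4 := A.le_sub κ
      unfold isNode at *
      rcases B with ⟨rfl, B⟩ | ⟨rfl, B⟩ | ⟨rfl, B⟩
      · split_ifs at * <;> omega
      · rw [show M + 1 - 1 = M by omega] at *
        split_ifs at * <;> omega
      · have e := B.2.2.1
        have e1 := e κ
        have e2 := e (κ - 1)
        split_ifs at * <;> omega
    · simp only [stair, stairInd]
      rw [if_neg (by omega), add_zero]
      exact h1
  · by_cases hb : q ≤ J ∧ i < q + M
    · refine ⟨k, B.switchCond (fun κ i' q' hκ => ?_) hq hqi hb.1 hb.2⟩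
      simp only [stair, stairInd]
      rw [if_neg (by omega), add_zero]
    · obtain ⟨k₀, h1, h2, h3, h4⟩ := exists_switchCond_faD a D hq hqi hin
      refine ⟨k₀, h1, h2, fun κ a1 a2 a3 => ?_, fun κ a1 a2 a3 => ?_⟩
      · simp only [stair, stairInd]
        rw [h3 κ a1 a2 a3, if_neg (by omega), if_neg (by omega)]
      · simp only [stair, stairInd]
        rw [h4 κ a1 a2 a3, if_neg (by omega), if_neg (by omega)]

lemma epsTot_faD_eq_zero (c a : ℕ → ℕ) {D : ℕ → ℤ} {i q : ℕ} (hq : 2 ≤ q) (hqi : q ≤ i)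
    (hi : i < n ∨ (i = n ∧ ∀ l, D l = 0)) : epsTot n c (faD n a D) i q = 0 := by
  refine Finset.sum_eq_zero fun κ hκ => ?_
  rw [Finset.mem_Icc] at hκ
  have n1 : isNode n κ (i - 1) (q - 1) := by unfold isNode; omega
  have n2 : isNode n κ i q := by unfold isNode; omega
  have hD : i < n ∨ (i = n ∧ D κ = 0 ∧ D (κ - 1) = 0) := hi.imp_right fun h => ⟨h.1, h.2 _, h.2 _⟩
  by_cases hm : i - q + 1 = κ
  · have n3 : ¬ isNode n κ i (q - 1) := by unfold isNode; omega
    have n4 : ¬ isNode n κ (i + 1) q := by unfold isNode; omega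
    simp only [epsN, fext, if_pos n1, if_pos n2, if_neg n3, if_neg n4, faD_of_node a D n1,
      faD_of_node a D n2]
    split_ifs <;> omega
  · have n3 : isNode n κ i (q - 1) := by unfold isNode; omega
    have n4 : isNode n κ (i + 1) q := by unfold isNode; omega
    simp only [epsN, fext, if_pos n1, if_pos n2, if_pos n3, if_pos n4, faD_of_node a D n1,
      faD_of_node a D n2, faD_of_node a D n3, faD_of_node a D n4]
    split_ifs <;> omega

lemma epsTot_faD_one (c a : ℕ → ℕ) {D : ℕ → ℤ} {i : ℕ} (hi1 : 1 ≤ i)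
    (hi : i < n ∨ (i = n ∧ ∀ l, D l = 0)) :
    epsTot n c (faD n a D) i 1 = (c i : ℤ) - a i - D i := by
  have key : ∀ κ ∈ Finset.Icc (i - 1 + 1) (n - 1 + 1), epsN n c (faD n a D) κ i 1 =
      (if κ = i then (c i : ℤ) - a i - max (D i) 0 else 0) +
      (if κ = i + 1 then - min (D i) 0 else 0) := by
    intro κ hκ
    rw [Finset.mem_Icc] at hκ
    have n1 : ¬ isNode n κ (i - 1) (1 - 1) := by unfold isNode; omega
    have n2 : isNode n κ i 1 := by unfold isNode; omega
    have n3 : ¬ isNode n κ i (1 - 1) := by unfold isNode; omega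
    have hD : i < n ∨ (i = n ∧ D i = 0) := hi.imp_right fun h => ⟨h.1, h.2 _⟩
    by_cases hm : κ = i
    · subst hm
      have n4 : ¬ isNode n κ (κ + 1) 1 := by unfold isNode; omega
      simp only [epsN, fext, if_neg n1, if_pos n2, if_neg n3, if_neg n4, faD_of_node a D n2]
      split_ifs <;> omega
    · have n4 : isNode n κ (i + 1) 1 := by unfold isNode; omega
      simp only [epsN, fext, if_neg n1, if_pos n2, if_neg n3, if_pos n4, faD_of_node a D n2,
        faD_of_node a D n4]
      by_cases hm' : κ = i + 1
      · subst hm'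
        rw [show i + 1 - 1 = i by omega]
        split_ifs <;> omega
      · split_ifs <;> omega
  rw [epsTot, Finset.sum_congr rfl key, Finset.sum_add_distrib, Finset.sum_ite_eq',
    Finset.sum_ite_eq', if_pos (Finset.mem_Icc.mpr (by omega))]
  rcases hi with hi | ⟨rfl, hi⟩
  · rw [if_pos (Finset.mem_Icc.mpr (by omega))]
    omega
  · rw [if_neg (by rw [Finset.mem_Icc]; omega), hi]
    omega

lemma Admissible.isBlock (A : Admissible n c a D) (B : BlockData n c a D k M J) (hM : 1 ≤ M) :
    IsBlock n c (faD n a D) k M J := by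
  have hcol : ∀ i, i < M + J → i < n ∨ (i = n ∧ ∀ l, D l = 0) := by
    rcases B with ⟨_, B⟩ | ⟨_, B⟩ | ⟨_, B⟩
    · exact fun i hi => Or.inl (by omega)
    · exact fun i hi => Or.inl (by omega)
    · intro i hi
      rcases (show i < n ∨ i = n by omega) with h | h
      · exact Or.inl h
      · exact Or.inr ⟨h, B.2.2.1⟩
  have hdims : M ≤ k ∧ k ≤ n ∧ J ≤ n - k + 1 := by unfold BlockData at B; omega
  refine ⟨hM, hdims.1, hdims.2.1, hdims.2.2,
    fun j m hj hjJ hm => A.feasible_stair B j m hjJ,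
    fun j m hj hjJ hm hmM => B.switchCond (fun κ i' q' hκ => ?_) hj (by omega) hjJ (by omega),
    fun j hj hjJ => ?_, fun j m hj hjJ hm hmM => ?_,
    fun i q hq hqi hi => epsTot_faD_eq_zero c a hq hqi (hcol i hi),
    fun i hi1 hi => ?_, ?_⟩
  · simp only [stair, stairInd]
    rw [if_neg (by omega), add_zero]
  · rcases B with ⟨rfl, B⟩ | ⟨rfl, B⟩ | ⟨rfl, B⟩
    · exact Or.inl rfl
    · right
      rw [faD_of_node a D (by unfold isNode; omega), faD_of_node a D (by unfold isNode; omega),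
        show M + 1 - 1 = M by omega]
      split_ifs <;> omega
    · exact Or.inl rfl
  · exact faD_mono_ascending (i := m + j) a D (by unfold isNode; omega)
      (by unfold isNode; omega)
  · rw [epsTot_faD_one c a hi1 (hcol i hi)]
    have h1 := A.le_param i
    have h2 := A.le_sub i
    rcases hcol i hi with h | ⟨h, h'⟩
    · omega
    · rw [h']
      omega
  · rw [epsTot_faD_one c a hM (hcol M (by unfold BlockData at B; omega))]
    rcases B with ⟨rfl, B⟩ | ⟨rfl, B⟩ | ⟨rfl, B⟩
    · omega
    · have := A.le_param M hM (by omega)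
      omega
    · rw [B.2.2.1]
      omega

lemma eq_stair_of_node {f g : ℕ × ℕ × ℕ → ℤ} {k M j m : ℕ} (hk : k ≤ n) (hM : M ≤ k)
    (hj : j ≤ n - k + 2) (hm : j = n - k + 2 → M ≤ m)
    (hf : ∀ κ i q, ¬ isNode n κ i q → f (κ, i, q) = 0)
    (hg : ∀ κ i q, ¬ isNode n κ i q → g (κ, i, q) = 0)
    (hfg : ∀ κ i q, isNode n κ i q → g (κ, i, q) = f (κ, i, q) + stairInd k M j m κ i q) :
    g = stair f k M j m := by
  funext ⟨κ, i, q⟩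
  by_cases h : isNode n κ i q
  · exact hfg κ i q h
  · have h0 : stairInd k M j m κ i q = 0 := if_neg (by unfold isNode at h; omega)
    simp only [stair, hf κ i q h, hg κ i q h, h0, add_zero]

/-- The string `S_{n-1,M}` increases the deviation in coordinate `M`. -/
lemma Admissible.path_deviation (A : Admissible n c a D) (hM : 1 ≤ M) (hMn : M < n)
    (hD : D M < (c M : ℤ) - a M) :
    KscrPath n c (SStr 0 (n - 1) M) (faD n a D)
      (faD n a (Function.update D M (D M + 1))) := by
  rcases le_or_gt 0 (D M) with h0 | h0
  · have B : BlockData n c a D M M (n - M) := Or.inl ⟨rfl, hMn, rfl, h0, hD⟩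
    convert (A.isBlock B hM).path (by omega) (N := n - 1) (by omega) using 1
    refine eq_stair_of_node (by omega) (by omega) (by omega) (by omega)
      (fun κ i q h => faD_of_not_node _ _ h) (fun κ i q h => faD_of_not_node _ _ h)
      fun κ i q h => ?_
    simp only [faD_of_node _ _ h, stairInd, Function.update_apply]
    unfold isNode at h
    by_cases hκ : κ = M
    · subst hκ
      split_ifs <;> omega
    · by_cases hκ' : κ - 1 = M
      · rw [hκ']
        split_ifs <;> omega
      · split_ifs <;> omega
  · have B : BlockData n c a D (M + 1) M (n - M) := Or.inr (Or.inl ⟨rfl, hMn, rfl, h0⟩)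
    convert (A.isBlock B hM).path (by omega) (N := n - 1) (by omega) using 1
    refine eq_stair_of_node (by omega) (by omega) (by omega) (by omega)
      (fun κ i q h => faD_of_not_node _ _ h) (fun κ i q h => faD_of_not_node _ _ h)
      fun κ i q h => ?_
    simp only [faD_of_node _ _ h, stairInd, Function.update_apply]
    unfold isNode at h
    by_cases hκ : κ = M
    · subst hκ
      split_ifs <;> omega
    · by_cases hκ' : κ - 1 = M
      · rw [hκ']
        split_ifs <;> omega
      · split_ifs <;> omega

/-- The string `S_{n,M}` increases coordinate `M` of a principal vertex. -/
lemma Admissible.path_coordinate (A : Admissible n c a 0) (hM : 1 ≤ M) (hMn : M ≤ n)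
    (ha : a M < c M) :
    KscrPath n c (SStr 0 n M) (faD n a 0) (faD n (Function.update a M (a M + 1)) 0) := by
  have B : BlockData n c a 0 M M (n - M + 1) :=
    Or.inr (Or.inr ⟨rfl, hMn, rfl, fun _ => rfl, ha⟩)
  convert (A.isBlock B hM).path (by omega) (N := n) (by omega) using 1
  refine eq_stair_of_node (by omega) (by omega) (by omega) (by omega)
    (fun κ i q h => faD_of_not_node _ _ h) (fun κ i q h => faD_of_not_node _ _ h)
    fun κ i q h => ?_
  simp only [faD_of_node _ _ h, stairInd, Function.update_apply, Pi.zero_apply]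
  unfold isNode at h
  by_cases hκ : κ = M
  · subst hκ
    simp only [if_true, true_and]
    push_cast
    split_ifs <;> omega
  · split_ifs <;> omega

end Block

section Iterate

variable {n : ℕ} {c a : ℕ → ℕ} {D : ℕ → ℤ} {M : ℕ}

lemma faD_congr {a a' : ℕ → ℕ} {D D' : ℕ → ℤ} (ha : ∀ k, 1 ≤ k → k ≤ n → a k = a' k)
    (hD : ∀ k, 1 ≤ k → k ≤ n - 1 → D k = D' k) : faD n a D = faD n a' D' := by
  funext ⟨κ, i, q⟩
  by_cases h : isNode n κ i q
  · rw [faD_of_node _ _ h, faD_of_node _ _ h]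
    unfold isNode at h
    have h1 := ha κ (by omega) (by omega)
    have h2 := hD κ
    have h3 := hD (κ - 1)
    split_ifs <;> omega
  · rw [faD_of_not_node _ _ h, faD_of_not_node _ _ h]

lemma flatten_replicate_succ (t : ℕ) (L : List ℕ) :
    (List.replicate (t + 1) L).flatten = (List.replicate t L).flatten ++ L := by
  simp [List.replicate_succ']

lemma Admissible.update_deviation (A : Admissible n c a D) {x : ℤ} (h : D M ≤ x)
    (hD : x ≤ (c M : ℤ) - a M) : Admissible n c a (Function.update D M x) := by
  refine ⟨A.le_param, fun k h1 h2 => ?_, fun k h1 h2 => ?_⟩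
  · have := A.neg_le k h1 h2
    rw [Function.update_apply]
    split_ifs with hk
    · subst hk
      omega
    · exact this
  · have := A.le_sub k h1 h2
    rw [Function.update_apply]
    split_ifs with hk
    · subst hk
      omega
    · exact this

lemma Admissible.path_deviation_iterate (A : Admissible n c a D) (hM : 1 ≤ M) (hMn : M < n)
    (t : ℕ) (hD : D M + t ≤ (c M : ℤ) - a M) :
    KscrPath n c (List.replicate t (SStr 0 (n - 1) M)).flatten (faD n a D)
      (faD n a (Function.update D M (D M + t))) := by
  induction t with
  | zero => simpa using KscrPath.nil A.feasible
  | succ t ih =>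
    rw [flatten_replicate_succ]
    refine (ih (by omega)).append ?_
    have := (A.update_deviation (M := M) (x := D M + t) (by omega) (by omega)).path_deviation
      hM hMn (by rw [Function.update_self]; omega)
    rw [Function.update_self, Function.update_idem] at this
    rwa [show D M + ((t + 1 : ℕ) : ℤ) = D M + t + 1 by push_cast; ring]

lemma path_coordinate_iterate (ha : ∀ k, 1 ≤ k → k ≤ n → a k ≤ c k) (hM : 1 ≤ M)
    (hMn : M ≤ n) (t : ℕ) (ht : a M + t ≤ c M) :
    KscrPath n c (List.replicate t (SStr 0 n M)).flatten (faD n a 0)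
      (faD n (Function.update a M (a M + t)) 0) := by
  have adm : ∀ b : ℕ → ℕ, (∀ k, 1 ≤ k → k ≤ n → b k ≤ c k) → Admissible n c b 0 :=
    fun b hb => ⟨hb, fun k _ _ => by simp, fun k _ _ => by
      have := hb k (by omega) (by omega)
      simp only [Pi.zero_apply]
      omega⟩
  induction t with
  | zero => simpa using KscrPath.nil (adm a ha).feasible
  | succ t ih =>
    rw [flatten_replicate_succ]
    refine (ih (by omega)).append ?_
    have := (adm (Function.update a M (a M + t)) fun k h1 h2 => by
      rw [Function.update_apply]
      split_ifs with hk
      · subst hk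
        omega
      · exact ha k h1 h2).path_coordinate hM hMn (by rw [Function.update_self]; omega)
    rwa [Function.update_self, Function.update_idem] at this

/-- The deviation of the source of the upper subcrystal. -/
def sourceDev (n : ℕ) (a : ℕ → ℕ) (k : ℕ) : ℤ :=
  if 1 ≤ k ∧ k ≤ n - 1 then -(a (k + 1) : ℤ) else 0

lemma Admissible.path_from_source (A : Admissible n c a D) :
    KscrPath n c (prinStr 0 (n - 1) fun i => ((a (i + 1) : ℤ) + D i).toNat)
      (faD n a (sourceDev n a)) (faD n a D) := by
  let E : ℕ → ℕ → ℤ := fun t k => if k ≤ t then D k else sourceDev n a k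
  have hE : ∀ t, Admissible n c a (E t) := by
    refine fun t => ⟨A.le_param, fun k h1 h2 => ?_, fun k h1 h2 => ?_⟩
    · have := A.neg_le k h1 h2
      simp only [E, sourceDev]
      split_ifs <;> omega
    · have := A.le_sub k h1 h2
      have := A.le_param k h1 (by omega)
      simp only [E, sourceDev]
      split_ifs <;> omega
  have key := KscrPath.flatMap_range (n := n) (c := c)
    (fun t => (List.replicate (((a (0 + t + 1 + 1) : ℤ) + D (0 + t + 1)).toNat)
      (SStr 0 (n - 1) (t + 1))).flatten)
    (fun t => faD n a (E t)) (n - 1) (hE 0).feasible (fun t ht => by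
      have h1 := A.neg_le (t + 1) (by omega) (by omega)
      have h2 := A.le_sub (t + 1) (by omega) (by omega)
      have h3 : E t (t + 1) = -(a (t + 1 + 1) : ℤ) := by
        simp only [E, sourceDev]
        rw [if_neg (by omega), if_pos (by omega)]
      have h4 := (hE t).path_deviation_iterate (M := t + 1) (by omega) (by omega)
        (((a (t + 1 + 1) : ℤ) + D (t + 1)).toNat) (by omega)
      rw [zero_add]
      have h5 : E (t + 1) = Function.update (E t) (t + 1)
          (E t (t + 1) + (((a (t + 1 + 1) : ℤ) + D (t + 1)).toNat : ℤ)) := by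
        funext k
        rw [Function.update_apply]
        split_ifs with hk
        · subst hk
          rw [h3]
          simp only [E, le_refl, if_true]
          omega
        · simp only [E]
          exact if_congr (by omega) rfl rfl
      rwa [h5])
  have e0 : faD n a (E 0) = faD n a (sourceDev n a) :=
    faD_congr (fun _ _ _ => rfl) fun k h1 h2 => if_neg (by omega)
  have e1 : faD n a (E (n - 1)) = faD n a D :=
    faD_congr (fun _ _ _ => rfl) fun k h1 h2 => if_pos h2
  rw [e0, e1] at key
  exact key

lemma path_principal (ha : ∀ k, 1 ≤ k → k ≤ n → a k ≤ c k) :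
    KscrPath n c (prinStr 0 n a) 0 (faD n a 0) := by
  let E : ℕ → ℕ → ℕ := fun t k => if k ≤ t then a k else 0
  have hE : ∀ t k, 1 ≤ k → k ≤ n → E t k ≤ c k := by
    intro t k h1 h2
    have := ha k h1 h2
    simp only [E]
    split_ifs <;> omega
  have e0 : faD n (E 0) 0 = 0 := by
    funext ⟨κ, i, q⟩
    by_cases h : isNode n κ i q
    · rw [faD_of_node _ _ h]
      have : E 0 κ = 0 := if_neg (by unfold isNode at h; omega)
      simp [this]
    · exact faD_of_not_node _ _ h
  have h0 : Feasible n c (faD n (E 0) 0) := by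
    refine Admissible.feasible ⟨hE 0, fun k _ _ => by simp, fun k h1 h2 => ?_⟩
    have := hE 0 k h1 (by omega)
    simp only [Pi.zero_apply]
    omega
  have key := KscrPath.flatMap_range (n := n) (c := c)
    (fun t => (List.replicate (a (0 + t + 1)) (SStr 0 n (t + 1))).flatten)
    (fun t => faD n (E t) 0) n h0 (fun t ht => by
      have h3 : E t (t + 1) = 0 := if_neg (by omega)
      have h4 := path_coordinate_iterate (hE t) (M := t + 1) (by omega) (by omega)
        (a (t + 1)) (by have := ha (t + 1) (by omega) (by omega); omega)
      rw [zero_add]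
      have h5 : E (t + 1) = Function.update (E t) (t + 1) (E t (t + 1) + a (t + 1)) := by
        funext k
        rw [Function.update_apply]
        split_ifs with hk
        · subst hk
          rw [h3]
          simp [E]
        · simp only [E]
          exact if_congr (by omega) rfl rfl
      rwa [h5])
  have e1 : faD n (E n) 0 = faD n a 0 :=
    faD_congr (fun k h1 h2 => if_pos h2) fun _ _ _ => rfl
  rw [e0, e1] at key
  exact key

end Iterate

/-! ### Sources in the crossing model -/

lemma Kscr_edge {n : ℕ} {c : ℕ → ℕ} {i : ℕ} {f g : (Kscr n c).V}
    (h : (Kscr n c).F i f = some g) : ∃ k j, isNode n k i j ∧ g.1 = bump f.1 k i j := by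
  obtain ⟨f, hf⟩ := f
  obtain ⟨g, hg⟩ := g
  simp only [Kscr] at h
  split_ifs at h with h1 h2
  have e := congrArg Subtype.val (Option.some.inj h)
  dsimp only at e
  refine ⟨_, _, ?_, e.symm⟩
  by_contra hn
  have z1 := h2.1 _ _ _ hn
  have z2 := hf.1 _ _ _ hn
  simp only [bump, if_true] at z1
  omega

lemma lt_bump (f : ℕ × ℕ × ℕ → ℤ) (k i j : ℕ) : f < bump f k i j := by
  refine Pi.lt_def.mpr ⟨fun x => ?_, (k, i, j), ?_⟩
  · simp only [bump]
    split_ifs <;> omega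
  · simp [bump]

lemma KscrPath.exists_vertices {n : ℕ} {c : ℕ → ℕ} {L : List ℕ} {f g : ℕ × ℕ × ℕ → ℤ}
    (h : KscrPath n c L f g) :
    ∃ u v : (Kscr n c).V, u.1 = f ∧ v.1 = g ∧ applyStr (Kscr n c) L u = some v := by
  obtain ⟨hf, hg, h⟩ := h
  exact ⟨⟨f, hf⟩, ⟨g, hg⟩, rfl, rfl, h⟩

lemma Kscr_isSource_zero {n : ℕ} {c : ℕ → ℕ} {x : (Kscr n c).V} (hx : x.1 = 0) :
    IsSource (Kscr n c) x := by
  intro i g hg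
  obtain ⟨k, j, hn, e⟩ := Kscr_edge hg
  rw [hx] at e
  have h1 := congrFun e (k, i, j)
  have h2 := (g.2.2.2.2.1 k i j hn).1
  simp only [bump, if_true, Pi.zero_apply] at h1
  omega

lemma Kscr_isSource_upper {n : ℕ} {c a : ℕ → ℕ} {x : (Kscr n c).V}
    (hx : x.1 = faD n a (sourceDev n a)) {i : ℕ} (hi : i ≤ n - 1) (g : (Kscr n c).V) :
    (Kscr n c).F i g ≠ some x := by
  intro hg
  obtain ⟨k, j, hn, e⟩ := Kscr_edge hg
  rw [hx] at e
  have h1 := congrFun e (k, i, j)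
  have h2 := (g.2.2.2.2.1 k i j hn).1
  simp only [bump, if_true] at h1
  have hk : i - j + 1 = k := by
    by_contra hk
    rw [faD_of_node _ _ hn] at h1
    unfold isNode at hn
    simp only [sourceDev] at h1
    rw [show k - 1 + 1 = k by omega] at h1
    split_ifs at h1 <;> omega
  have hn' : isNode n k (i + 1) (j + 1) := by unfold isNode at *; omega
  have h3 := congrFun e (k, i + 1, j + 1)
  have h4 := g.2.2.2.1 k i j hn hn'
  simp only [bump, Prod.mk.injEq] at h3
  rw [if_neg (by omega)] at h3
  rw [← h3] at h4
  rw [faD_of_node _ _ hn] at h1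
  rw [faD_of_node _ _ hn'] at h4
  unfold isNode at *
  simp only [sourceDev] at h1 h4
  rw [show k - 1 + 1 = k by omega] at h1 h4
  split_ifs at h1 h4 <;> omega

/-! ### Uniqueness of sources of subcrystals -/

section Confluence

variable {K : PreGraph} {C I : Set ℕ}

/-- Directed edge with color in `I`. -/
def edgeOn (K : PreGraph) (I : Set ℕ) (u v : K.V) : Prop := ∃ i ∈ I, K.F i u = some v

lemma IsCrystalOn.Finv_eq_some (hK : IsCrystalOn K C) {i : ℕ} {u v : K.V} :
    K.Finv i v = some u ↔ K.F i u = some v := by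
  unfold PreGraph.Finv
  constructor
  · intro h
    split_ifs at h with hex
    rw [← Option.some.inj h]
    exact hex.choose_spec
  · intro h
    have hex : ∃ u, K.F i u = some v := ⟨u, h⟩
    rw [dif_pos hex, hK.1.2.2.1 i _ _ v hex.choose_spec h]

lemma IsCrystalOn.exists_common_ancestor (hK : IsCrystalOn K C) (hI : I ⊆ C) {u u' v : K.V}
    (hu : edgeOn K I u v) (hu' : edgeOn K I u' v) :
    ∃ w, Relation.ReflTransGen (edgeOn K I) w u ∧ Relation.ReflTransGen (edgeOn K I) w u' := by
  obtain ⟨i, hi, hu⟩ := hu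
  obtain ⟨j, hj, hu'⟩ := hu'
  have hFinv : ∀ {i u v}, K.Finv i v = some u ↔ K.F i u = some v := hK.Finv_eq_some
  obtain ⟨hcol, -, hA2, hA34, hA5⟩ := hK
  by_cases hij : i = j
  · subst hij
    rw [hcol.2.2.1 i u u' v hu hu']
    exact ⟨u', .refl, .refl⟩
  by_cases hfar : Far i j
  · obtain ⟨w, h1, h2⟩ := hA5 i (hI hi) j (hI hj) hfar (K.Finv i) (by simp) (K.Finv j) (by simp)
      v (by rw [hFinv.mpr hu]; rfl) (by rw [hFinv.mpr hu']; rfl)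
    rw [hFinv.mpr hu, Option.bind_some, hFinv] at h1
    rw [hFinv.mpr hu', Option.bind_some, hFinv] at h2
    exact ⟨w, .single ⟨j, hj, h1⟩, .single ⟨i, hi, h2⟩⟩
  have hn : Neighb i j := by unfold Far at hfar; unfold Neighb; omega
  have hn' : Neighb j i := hn.symm
  have l1 := (hA2 i (hI hi) j (hI hj) hij).1 u v hu
  have l2 := (hA2 j (hI hj) i (hI hi) (Ne.symm hij)).1 u' v hu'
  rw [if_pos hn] at l1
  rw [if_pos hn'] at l2
  by_cases e1 : (K.h j v : ℤ) - (K.h j u : ℤ) = 1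
  · obtain ⟨-, w, h1, h2⟩ := (hA34 i (hI hi) j (hI hj) hn).1.2 u u' v hu hu' e1
    exact ⟨w, .single ⟨j, hj, h1⟩, .single ⟨i, hi, h2⟩⟩
  by_cases e2 : (K.h i v : ℤ) - (K.h i u' : ℤ) = 1
  · obtain ⟨-, w, h1, h2⟩ := (hA34 j (hI hj) i (hI hi) hn').1.2 u' u v hu' hu e2
    exact ⟨w, .single ⟨j, hj, h2⟩, .single ⟨i, hi, h1⟩⟩
  obtain ⟨w, h1, h2⟩ := (hA34 i (hI hi) j (hI hj) hn).2.2 u u' v hu hu' (by omega) (by omega)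
  rw [hFinv.mpr hu, Option.bind_some] at h1
  rw [hFinv.mpr hu', Option.bind_some] at h2
  simp only [Option.bind_eq_some_iff, hFinv] at h1 h2
  obtain ⟨x, ⟨y, hy, hx⟩, hw⟩ := h1
  obtain ⟨x', ⟨y', hy', hx'⟩, hw'⟩ := h2
  exact ⟨w, ((Relation.ReflTransGen.single ⟨i, hi, hw⟩).tail ⟨j, hj, hx⟩).tail ⟨j, hj, hy⟩,
    ((Relation.ReflTransGen.single ⟨j, hj, hw'⟩).tail ⟨i, hi, hx'⟩).tail ⟨i, hi, hy'⟩⟩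

/-- In an acyclic crystal, each subcrystal has at most one source. -/
lemma IsCrystalOn.source_unique (hK : IsCrystalOn K C) (hI : I ⊆ C)
    (wf : WellFounded (edgeOn K I)) {x y : K.V} (hx : ∀ u, ¬ edgeOn K I u x)
    (hy : ∀ u, ¬ edgeOn K I u y) (hxy : inComp K I x y) : x = y := by
  have hex : ∀ v, ∃ z, (∀ u, ¬ edgeOn K I u z) ∧ Relation.ReflTransGen (edgeOn K I) z v := by
    intro v
    induction v using wf.induction with
    | _ v ih =>
      by_cases h : ∃ u, edgeOn K I u v
      · obtain ⟨u, hu⟩ := h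
        obtain ⟨z, hz, hzu⟩ := ih u hu
        exact ⟨z, hz, hzu.tail hu⟩
      · exact ⟨v, not_exists.mp h, .refl⟩
  have huniq : ∀ v x y, (∀ u, ¬ edgeOn K I u x) → (∀ u, ¬ edgeOn K I u y) →
      Relation.ReflTransGen (edgeOn K I) x v → Relation.ReflTransGen (edgeOn K I) y v →
      x = y := by
    intro v
    induction v using wf.induction with
    | _ v ih =>
      intro x y hx hy hxv hyv
      rcases Relation.ReflTransGen.cases_tail hxv with rfl | ⟨u, hxu, hu⟩
      · rcases Relation.ReflTransGen.cases_tail hyv with rfl | ⟨u', hyu, hu'⟩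
        · rfl
        · exact absurd hu' (hx u')
      · rcases Relation.ReflTransGen.cases_tail hyv with rfl | ⟨u', hyu, hu'⟩
        · exact absurd hu (hy u)
        · obtain ⟨w, hwu, hwu'⟩ := hK.exists_common_ancestor hI hu hu'
          obtain ⟨z, hz, hzw⟩ := hex w
          rw [ih u hu x z hx hz hxu (hzw.trans hwu), ih u' hu' y z hy hz hyu (hzw.trans hwu')]
  have hreach : Relation.ReflTransGen (edgeOn K I) x y := by
    clear hy
    induction hxy with
    | refl => exact .refl
    | tail _ hstep ih =>
      obtain ⟨i, hi, h | h⟩ := hstep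
      · exact ih.tail ⟨i, hi, h⟩
      · obtain ⟨z, hz, hzv⟩ := hex _
        rw [huniq _ x z hx hz ih (hzv.tail ⟨i, hi, h⟩)]
        exact hzv
  exact huniq y x y hx hy hreach .refl

end Confluence

/-! ### Strings in subcrystals and under isomorphisms -/

lemma sub_F_eq_some {K : PreGraph} {I : Set ℕ} {v : K.V} {i : ℕ} {u w : (K.sub I v).V} :
    (K.sub I v).F i u = some w ↔ i ∈ I ∧ K.F i u.1 = some w.1 := by
  obtain ⟨w, hw⟩ := w
  by_cases hi : i ∈ I
  · refine Iff.trans ?_ (and_iff_right hi).symm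
    change (if hi : i ∈ I then (K.F i u.1).pbind fun w hw => some (⟨w, _⟩ : (K.sub I v).V)
      else none) = some ⟨w, hw⟩ ↔ _
    rw [dif_pos hi, Option.pbind_eq_some_iff]
    constructor
    · rintro ⟨b, hb, h⟩
      rw [← congrArg Subtype.val (Option.some.inj h)]
      exact hb
    · exact fun h => ⟨w, h, rfl⟩
  · refine iff_of_false (fun h => ?_) fun h => hi h.1
    change (if hi : i ∈ I then (K.F i u.1).pbind fun w hw => some (⟨w, _⟩ : (K.sub I v).V)
      else none) = some ⟨w, hw⟩ at h
    rw [dif_neg hi] at h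
    cases h

lemma applyStr_of_sub {K : PreGraph} {I : Set ℕ} {v : K.V} {L : List ℕ} {u w : (K.sub I v).V}
    (h : applyStr (K.sub I v) L u = some w) : applyStr K L u.1 = some w.1 := by
  induction L generalizing u with
  | nil => exact congrArg some (congrArg Subtype.val (Option.some.inj h))
  | cons i L ih =>
    simp only [applyStr, Option.bind_eq_some_iff] at h ⊢
    obtain ⟨x, hx, hxw⟩ := h
    exact ⟨x.1, (sub_F_eq_some.mp hx).2, ih hxw⟩

lemma applyStr_equiv {K K' : PreGraph} (e : K.V ≃ K'.V)
    (he : ∀ i u v, K.F i u = some v ↔ K'.F i (e u) = some (e v)) {L : List ℕ} {u v : K.V} :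
    applyStr K L u = some v ↔ applyStr K' L (e u) = some (e v) := by
  induction L generalizing u with
  | nil => simp [applyStr]
  | cons i L ih =>
    simp only [applyStr, Option.bind_eq_some_iff]
    constructor
    · rintro ⟨x, hx, hxv⟩
      exact ⟨e x, (he i u x).mp hx, ih.mp hxv⟩
    · rintro ⟨x, hx, hxv⟩
      obtain ⟨x, rfl⟩ := e.surjective x
      exact ⟨x, (he i u x).mpr hx, ih.mpr hxv⟩

lemma inComp_of_applyStr {K : PreGraph} {I : Set ℕ} {L : List ℕ} (hL : ∀ i ∈ L, i ∈ I)
    {u v : K.V} (h : applyStr K L u = some v) : inComp K I v u := by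
  induction L generalizing u with
  | nil => rw [Option.some.inj h]; exact .refl
  | cons i L ih =>
    simp only [applyStr, Option.bind_eq_some_iff] at h
    obtain ⟨x, hx, hxv⟩ := h
    exact (ih (fun j hj => hL j (List.mem_cons_of_mem i hj)) hxv).tail
      ⟨i, hL i List.mem_cons_self, Or.inr hx⟩

lemma mem_prinStr {m i : ℕ} {a : ℕ → ℕ} (h : i ∈ prinStr 0 m a) : i ∈ Set.Icc 1 m := by
  simp only [prinStr, SStr, wStr, List.mem_flatMap, List.mem_range, List.mem_flatten,
    List.mem_replicate] at h
  obtain ⟨k, hk, L, ⟨-, rfl⟩, h⟩ := h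
  simp only [List.mem_flatMap, List.mem_range, List.mem_map] at h
  obtain ⟨j, hj, t, ht, rfl⟩ := h
  rw [Set.mem_Icc]
  omega


/-- the function `f_{a,D}` is feasible in the crossing model for `c`, and
under the isomorphism between `K(c)` and the crossing-model graph `Kscr(c)` it corresponds
to the principal vertex `v^up[a|D]` of the upper subcrystal `K^up[a]` with deviation `D`. -/
theorem faD_feasible_and_represents
    (n : ℕ) (K : PreGraph) (hK : IsACrystal n K)
    (s : K.V) (hs : IsSource K s)
    (c : ℕ → ℕ) (hc : ∀ i, 1 ≤ i → i ≤ n → K.h i s = c i)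
    (a : ℕ → ℕ) (ha : ∀ i, 1 ≤ i → i ≤ n → a i ≤ c i)
    (D : ℕ → ℤ) (hD0 : D 0 = 0) (hDn : D n = 0)
    (hD : ∀ k, 1 ≤ k → k ≤ n - 1 →
      -(a (k + 1) : ℤ) ≤ D k ∧ D k ≤ (c k : ℤ) - (a k : ℤ)) :
    Feasible n c (faD n a D) ∧
    ∀ (e : K.V ≃ (Kscr n c).V),
      (∀ i u v, K.F i u = some v ↔ (Kscr n c).F i (e u) = some (e v)) →
      ∀ pa : K.V, IsPrin K 0 n s a pa →
      ∀ s' : (K.sub (Set.Icc 1 (n - 1)) pa).V,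
        IsSource (K.sub (Set.Icc 1 (n - 1)) pa) s' →
      ∀ z : (K.sub (Set.Icc 1 (n - 1)) pa).V,
        IsPrin (K.sub (Set.Icc 1 (n - 1)) pa) 0 (n - 1) s'
          (fun i => ((a (i + 1) : ℤ) + D i).toNat) z →
        (e z.1).1 = faD n a D := by
  have A : Admissible n c a D :=
    ⟨ha, fun k h1 h2 => (hD k h1 h2).1, fun k h1 h2 => (hD k h1 h2).2⟩
  refine ⟨A.feasible, fun e he pa hpa s' hs' z hz => ?_⟩
  have wf : ∀ I, WellFounded (edgeOn K I) := by
    intro I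
    have : Finite K.V := hK.1.1
    have wf' : WellFounded fun u v : K.V => (e u).1 < (e v).1 := by
      have : IsTrans K.V fun u v : K.V => (e u).1 < (e v).1 := ⟨fun _ _ _ => lt_trans⟩
      have : Std.Irrefl fun u v : K.V => (e u).1 < (e v).1 := ⟨fun _ => lt_irrefl _⟩
      exact Finite.wellFounded_of_trans_of_irrefl _
    refine Subrelation.wf (fun {u v} h => ?_) wf'
    obtain ⟨i, -, h⟩ := h
    obtain ⟨k, j, -, h⟩ := Kscr_edge ((he i u v).mp h)
    rw [h]
    exact lt_bump _ _ _ _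
  obtain ⟨x₀, xa, hx₀, hxa, hpath⟩ := (path_principal ha).exists_vertices
  have hes : s = e.symm x₀ := by
    refine hK.source_unique subset_rfl (wf _) (fun u ⟨i, _, hu⟩ => hs i u hu)
      (fun u ⟨i, _, hu⟩ => ?_) ?_
    · rw [he, Equiv.apply_symm_apply] at hu
      exact Kscr_isSource_zero hx₀ i _ hu
    · refine Relation.ReflTransGen.mono (r := K.Step) (p := stepOn K (Set.Icc 1 n))
        (fun u v ⟨i, h⟩ => ⟨i, ?_, h⟩) _ _ (hK.2.1 s _)
      by_contra hi
      rcases h with h | h <;> rw [hK.1.2.1 i hi] at h <;> cases h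
  have hpa' : e pa = xa := by
    have h := (applyStr_equiv e he).mp hpa
    rw [hes, Equiv.apply_symm_apply, hpath] at h
    exact (Option.some.inj h).symm
  have A0 : Admissible n c a 0 := ⟨ha, fun k _ _ => by simp, fun k h1 h2 => by
    have := ha k h1 (by omega)
    simp only [Pi.zero_apply]
    omega⟩
  obtain ⟨x, y, hx, hy, hup⟩ := A0.path_from_source.exists_vertices
  obtain ⟨x', xD, hx', hxD, hupD⟩ := A.path_from_source.exists_vertices
  obtain rfl : x = x' := Subtype.ext (hx.trans hx'.symm)
  obtain rfl : y = xa := Subtype.ext (hy.trans hxa.symm)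
  have hes' : s'.1 = e.symm x := by
    refine hK.source_unique (I := Set.Icc 1 (n - 1))
      (Set.Icc_subset_Icc_right (Nat.sub_le n 1)) (wf _) (fun u ⟨i, hi, hu⟩ => ?_)
      (fun u ⟨i, hi, hu⟩ => ?_) ?_
    · exact hs' i ⟨u, s'.2.tail ⟨i, hi, Or.inr hu⟩⟩ (sub_F_eq_some.mpr ⟨hi, hu⟩)
    · rw [he, Equiv.apply_symm_apply] at hu
      exact Kscr_isSource_upper hx hi.2 _ hu
    · have h1 : inComp K (Set.Icc 1 (n - 1)) pa (e.symm x) := by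
        rw [← hpa', ← Equiv.apply_symm_apply e x, ← applyStr_equiv e he] at hup
        exact inComp_of_applyStr (fun i hi => mem_prinStr hi) hup
      have : Std.Symm (stepOn K (Set.Icc 1 (n - 1))) := ⟨fun u v ⟨i, hi, h⟩ => ⟨i, hi, h.symm⟩⟩
      exact (Relation.ReflTransGen.stdSymm.symm _ _ s'.2).trans h1
  have h := (applyStr_equiv e he).mp (applyStr_of_sub hz)
  rw [hes', Equiv.apply_symm_apply, hupD] at h
  rw [← Option.some.inj h, hxD]
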